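/- Let H₁ and H₂ be complex inner product spaces. There do not exist vectors u₀, u₁ ∈ H₁ and w₀, w₁ ∈ H₂ such that the four vectors ψ_{ij} = (u_i, w_j) ∈ H₁ × H₂, for i, j ∈ {0,1}, form an orthonormal family (i.e. each ψ_{ij} has norm 1 and ⟨ψ_{ij}, ψ_{i'j'}⟩ = 0 whenever (i,j) ≠ (i',j')). -/

import Mathlib

/-- **No orthonormal product-form family.**
Let `H₁`, `H₂` be complex inner product spaces, and endow `H₁ × H₂` with the product
inner product (the `L²` product `WithLp 2 (H₁ × H₂)`).  There do not exist vectors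
`u₀ u₁ : H₁` and `w₀ w₁ : H₂` such that the four vectors `ψ_{ij} = (u_i, w_j)`,
`i j ∈ {0,1}`, form an orthonormal family. -/
theorem no_orthonormal_product_family {H₁ H₂ : Type*}
    [NormedAddCommGroup H₁] [InnerProductSpace ℂ H₁]
    [NormedAddCommGroup H₂] [InnerProductSpace ℂ H₂] :
    ¬ ∃ (u : Fin 2 → H₁) (w : Fin 2 → H₂),
        Orthonormal ℂ (fun p : Fin 2 × Fin 2 =>
          (WithLp.equiv 2 (H₁ × H₂)).symm (u p.1, w p.2)) := by
  rintro ⟨u, w, h⟩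
  rw [orthonormal_iff_ite] at h
  have h1 := h (0, 0) (0, 0)
  have h2 := h (0, 0) (0, 1)
  have h3 := h (0, 0) (1, 0)
  have h4 := h (0, 0) (1, 1)
  rw [if_pos rfl] at h1
  rw [if_neg (by decide)] at h2 h3 h4
  rw [WithLp.prod_inner_apply] at h1 h2 h3 h4
  change inner ℂ (u 0) (u 0) + inner ℂ (w 0) (w 0) = _ at h1
  change inner ℂ (u 0) (u 0) + inner ℂ (w 0) (w 1) = _ at h2
  change inner ℂ (u 0) (u 1) + inner ℂ (w 0) (w 0) = _ at h3
  change inner ℂ (u 0) (u 1) + inner ℂ (w 0) (w 1) = _ at h4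
  have key : (1 : ℂ) = 0 := by
    linear_combination h2 + h3 - h1 - h4
  exact one_ne_zero key
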